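/- Fix integers m ≥ 2 and k ≥ 1 and reals β ≥ 0 and α ≥ 1. Then every robust algorithm for class constrained scheduling on m identical machines with class bound k having migration factor β that is α-competitive satisfies α ≥ m; that is, no robust algorithm with constant migration factor for class constrained scheduling on identical machines has competitive ratio smaller than the number m of machines. -/

import Mathlib

open Finset

/-- The load of machine `i` under schedule `σ` for job sizes `p`. -/
noncomputable def machineLoad {n m : ℕ} (p : Fin n → ℝ) (σ : Fin n → Fin m) (i : Fin m) : ℝ :=
  ∑ j ∈ Finset.univ.filter (fun j => σ j = i), p j

/-- The makespan of a schedule: the maximum machine load. -/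
noncomputable def makespan {n m : ℕ} (p : Fin n → ℝ) (σ : Fin n → Fin m) : ℝ :=
  sSup (Set.range (machineLoad p σ))

/-- A schedule is feasible for cardinality bound `k` if every machine gets at most `k` jobs. -/
def Feasible {n m : ℕ} (k : ℕ) (σ : Fin n → Fin m) : Prop :=
  ∀ i : Fin m, (Finset.univ.filter (fun j => σ j = i)).card ≤ k

/-- The optimal (minimum) makespan over all feasible schedules on `m` machines with
cardinality bound `k`. -/
noncomputable def OPT (m k : ℕ) {n : ℕ} (p : Fin n → ℝ) : ℝ :=
  sInf ((fun σ : Fin n → Fin m => makespan p σ) '' {σ | Feasible k σ})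

/-- The schedule induced by a deterministic online algorithm `A` on input sequence `p`:
job `j` is assigned to the machine `A (p 1, …, p j)`. -/
def onlineSchedule {m : ℕ} (A : List ℝ → Fin m) {n : ℕ} (p : Fin n → ℝ) : Fin n → Fin m :=
  fun j => A ((List.ofFn p).take (j.1 + 1))

/-- An online algorithm is `α`-competitive if on every input sequence of at most `m*k`
nonnegative jobs the induced schedule is feasible and its makespan is at most `α * OPT`. -/
def Competitive (m k : ℕ) (A : List ℝ → Fin m) (α : ℝ) : Prop :=
  ∀ n : ℕ, n ≤ m * k → ∀ p : Fin n → ℝ, (∀ j, 0 ≤ p j) →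
    Feasible k (onlineSchedule A p) ∧
      makespan p (onlineSchedule A p) ≤ α * OPT m k p

/-- Class constrained feasibility: each job is a pair (size, class); a schedule is feasible
if the jobs assigned to each machine belong to at most `k` distinct classes. -/
def ClFeasible {t m : ℕ} (k : ℕ) (jobs : Fin t → ℝ × ℕ) (σ : Fin t → Fin m) : Prop :=
  ∀ i : Fin m,
    ((Finset.univ.filter (fun j => σ j = i)).image (fun j => (jobs j).2)).card ≤ k

/-- The minimum makespan over all feasible schedules for class constrained scheduling. -/
noncomputable def ClOPT (m k : ℕ) {t : ℕ} (jobs : Fin t → ℝ × ℕ) : ℝ :=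
  sInf ((fun σ : Fin t → Fin m => makespan (fun j => (jobs j).1) σ) ''
    {σ | ClFeasible k jobs σ})

/-- An algorithm for class constrained scheduling processing jobs one by one: after the
`t`-th job it outputs a schedule of jobs `1, …, t` determined by the sizes and classes of the
first `t` jobs. -/
def ClRobustAlg (m : ℕ) := ∀ t : ℕ, (Fin t → ℝ × ℕ) → Fin t → Fin m

/-- The first `t` jobs of an infinite sequence of (size, class) pairs. -/
def clPrefix (J : ℕ → ℝ × ℕ) (t : ℕ) : Fin t → ℝ × ℕ := fun j => J j.1

/-- `R` is a robust algorithm for class constrained scheduling on `m` machines with class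
bound `k` and migration factor `β`: on every input sequence with nonnegative sizes,
(i) the schedule `σ_t` is feasible whenever a feasible schedule of jobs `1, …, t` exists, and
(ii) the total size of the jobs `j < t` with `σ_t j ≠ σ_{t-1} j` is at most `β` times the
size of the `t`-th job. -/
def ClIsRobust (m k : ℕ) (β : ℝ) (R : ClRobustAlg m) : Prop :=
  ∀ J : ℕ → ℝ × ℕ, (∀ j, 0 ≤ (J j).1) →
    (∀ t : ℕ, (∃ τ : Fin t → Fin m, ClFeasible k (clPrefix J t) τ) →
      ClFeasible k (clPrefix J t) (R t (clPrefix J t))) ∧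
    (∀ s : ℕ,
      (∑ j ∈ Finset.univ.filter
          (fun j : Fin s =>
            R (s + 1) (clPrefix J (s + 1)) j.castSucc ≠ R s (clPrefix J s) j),
        (J j.1).1) ≤ β * (J s).1)

/-- A robust algorithm for class constrained scheduling is `α`-competitive if for every `t`
for which a feasible schedule of jobs `1, …, t` exists, the makespan of its schedule is at
most `α` times the minimum makespan of a feasible schedule of these jobs. -/
def ClRobustCompetitive (m k : ℕ) (R : ClRobustAlg m) (α : ℝ) : Prop :=
  ∀ J : ℕ → ℝ × ℕ, (∀ j, 0 ≤ (J j).1) → ∀ t : ℕ,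
    (∃ τ : Fin t → Fin m, ClFeasible k (clPrefix J t) τ) →
      makespan (fun j : Fin t => (J j.1).1) (R t (clPrefix J t)) ≤
        α * ClOPT m k (clPrefix J t)

theorem machineLoad_le_makespan {n m : ℕ} (p : Fin n → ℝ) (σ : Fin n → Fin m) (i : Fin m) :
    machineLoad p σ i ≤ makespan p σ :=
  le_csSup (Set.finite_range _).bddAbove ⟨i, rfl⟩

theorem machineLoad_nonneg {n m : ℕ} {p : Fin n → ℝ} (hp : ∀ j, 0 ≤ p j) (σ : Fin n → Fin m)
    (i : Fin m) : 0 ≤ machineLoad p σ i :=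
  Finset.sum_nonneg fun j _ => hp j

theorem makespan_nonneg {n m : ℕ} {p : Fin n → ℝ} (hp : ∀ j, 0 ≤ p j) (σ : Fin n → Fin m) :
    0 ≤ makespan p σ := by
  apply Real.sSup_nonneg
  rintro _ ⟨i, rfl⟩
  exact machineLoad_nonneg hp σ i

theorem ClOPT_le_makespan {m k t : ℕ} {jobs : Fin t → ℝ × ℕ} (hp : ∀ j, 0 ≤ (jobs j).1)
    {σ : Fin t → Fin m} (hσ : ClFeasible k jobs σ) :
    ClOPT m k jobs ≤ makespan (fun j => (jobs j).1) σ := by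
  refine csInf_le ⟨0, ?_⟩ ⟨σ, hσ, rfl⟩
  rintro _ ⟨τ, -, rfl⟩
  exact makespan_nonneg hp τ

/-- If all `m * k` available class slots are needed, a feasible schedule puts every class on a
single machine. -/
theorem ClFeasible.eq_of_class_eq {m k t : ℕ} {jobs : Fin t → ℝ × ℕ} {σ : Fin t → Fin m}
    (hσ : ClFeasible k jobs σ)
    (hcard : m * k ≤ (Finset.univ.image fun j => (jobs j).2).card) {a b : Fin t}
    (hab : (jobs a).2 = (jobs b).2) : σ a = σ b := by
  by_contra hne
  set P : Finset (Fin m × ℕ) := Finset.univ.image fun j => (σ j, (jobs j).2) with hP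
  have hmem : ∀ j, (σ j, (jobs j).2) ∈ P := fun j => by
    rw [hP]; exact Finset.mem_image_of_mem _ (Finset.mem_univ j)
  have upper : P.card ≤ m * k := by
    have hP' : P ⊆ (Finset.univ.sigma fun i : Fin m =>
        (Finset.univ.filter fun j => σ j = i).image fun j => (jobs j).2).image
          fun x => (x.1, x.2) := by
      intro x hx
      simp only [hP, Finset.mem_image, Finset.mem_univ, true_and] at hx
      obtain ⟨j, rfl⟩ := hx
      refine Finset.mem_image.2 ⟨⟨σ j, (jobs j).2⟩, ?_, rfl⟩
      simp only [Finset.mem_sigma, Finset.mem_univ, true_and, Finset.mem_image,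
        Finset.mem_filter]
      exact ⟨j, rfl, rfl⟩
    calc P.card ≤ _ := Finset.card_le_card hP'
      _ ≤ _ := Finset.card_image_le
      _ = ∑ i : Fin m, _ := Finset.card_sigma _ _
      _ ≤ ∑ _i : Fin m, k := Finset.sum_le_sum fun i _ => hσ i
      _ = m * k := by simp
  have lower : (Finset.univ.image fun j => (jobs j).2) ⊆
      (P.erase (σ a, (jobs a).2)).image Prod.snd := by
    intro c hc
    simp only [Finset.mem_image, Finset.mem_univ, true_and] at hc
    obtain ⟨j, rfl⟩ := hc
    by_cases hj : (σ j, (jobs j).2) = (σ a, (jobs a).2)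
    · refine Finset.mem_image.2 ⟨(σ b, (jobs b).2), Finset.mem_erase.2 ⟨?_, hmem b⟩, ?_⟩
      · exact fun h => hne (congrArg Prod.fst h).symm
      · exact hab.symm.trans (congrArg Prod.snd hj).symm
    · exact Finset.mem_image.2 ⟨_, Finset.mem_erase.2 ⟨hj, hmem j⟩, rfl⟩
  have h1 := (Finset.card_le_card lower).trans Finset.card_image_le
  have h2 := Finset.card_erase_lt_of_mem (hmem a)
  omega

/-- Placing every job of class `c` on machine `c / k` is feasible. -/
theorem clFeasible_of_div {m k t : ℕ} (hk : 1 ≤ k) {jobs : Fin t → ℝ × ℕ} {σ : Fin t → Fin m}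
    (hσ : ∀ j, (σ j : ℕ) = (jobs j).2 / k) : ClFeasible k jobs σ := by
  intro i
  have hsub : ((Finset.univ.filter (fun j => σ j = i)).image (fun j => (jobs j).2)) ⊆
      Finset.Ico (k * i) (k * i + k) := by
    intro c hc
    simp only [Finset.mem_image, Finset.mem_filter, Finset.mem_univ, true_and] at hc
    obtain ⟨j, rfl, rfl⟩ := hc
    rw [hσ j, Finset.mem_Ico]
    have h1 := Nat.div_add_mod (jobs j).2 k
    have h2 := Nat.mod_lt (jobs j).2 hk
    omega
  simpa using Finset.card_le_card hsub

/-- With zero-size arrivals from time `s` on, jobs of positive size never move. -/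
theorem ClIsRobust.eq_of_size_zero {m k : ℕ} {β : ℝ} {R : ClRobustAlg m}
    (hrob : ClIsRobust m k β R) {J : ℕ → ℝ × ℕ} (hJ : ∀ j, 0 ≤ (J j).1) {s : ℕ}
    (hzero : ∀ j, s ≤ j → (J j).1 = 0) (d : ℕ) {j : ℕ} (hj : j < s) (hpos : 0 < (J j).1) :
    R (s + d) (clPrefix J (s + d)) ⟨j, by omega⟩ = R s (clPrefix J s) ⟨j, hj⟩ := by
  induction d with
  | zero => rfl
  | succ d ih =>
    rw [← ih]
    by_contra hne
    have h := (hrob J hJ).2 (s + d)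
    rw [hzero (s + d) (by omega), mul_zero] at h
    have hle := Finset.single_le_sum
      (s := Finset.univ.filter (fun j : Fin (s + d) =>
        R (s + d + 1) (clPrefix J (s + d + 1)) j.castSucc ≠ R (s + d) (clPrefix J (s + d)) j))
      (f := fun j => (J j.1).1) (fun j _ => hJ j.1)
      (a := ⟨j, by omega⟩) (Finset.mem_filter.2 ⟨Finset.mem_univ _, hne⟩)
    exact absurd (hle.trans h) (not_le.2 hpos)

/-- The adversarial input: `m` unit jobs of class `0`, then zero-size jobs of new classes. -/
def unitsThenFreshClasses (m : ℕ) (j : ℕ) : ℝ × ℕ :=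
  if j < m then (1, 0) else (0, j + 1 - m)

theorem unitsThenFreshClasses_of_lt {m j : ℕ} (h : j < m) :
    unitsThenFreshClasses m j = (1, 0) := if_pos h

theorem unitsThenFreshClasses_of_le {m j : ℕ} (h : m ≤ j) :
    unitsThenFreshClasses m j = (0, j + 1 - m) := if_neg h.not_gt

theorem unitsThenFreshClasses_size_nonneg (m j : ℕ) : 0 ≤ (unitsThenFreshClasses m j).1 := by
  unfold unitsThenFreshClasses
  split_ifs <;> simp

/-- Lower bound for class constrained scheduling: for `m ≥ 2` machines and class bound
`k ≥ 1`, every robust algorithm with migration factor `β` that is `α`-competitive satisfies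
`α ≥ m`. -/
theorem class_constrained_robust_lower_bound (m k : ℕ) (hm : 2 ≤ m) (hk : 1 ≤ k)
    (β α : ℝ) (hβ : 0 ≤ β) (hα : 1 ≤ α)
    (R : ClRobustAlg m)
    (hrob : ClIsRobust m k β R) (hcomp : ClRobustCompetitive m k R α) :
    (m : ℝ) ≤ α := by
  set J := unitsThenFreshClasses m with hJdef
  have hJ : ∀ j, 0 ≤ (J j).1 := unitsThenFreshClasses_size_nonneg m
  have hlt : ∀ j, j < m → J j = (1, 0) := fun j => unitsThenFreshClasses_of_lt
  have hge : ∀ j, m ≤ j → J j = (0, j + 1 - m) := fun j => unitsThenFreshClasses_of_le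
  have hmk : 1 ≤ m * k := Nat.mul_pos (by omega) hk
  -- Spreading the unit jobs over all machines has makespan one.
  have hid : ClFeasible k (clPrefix J m) (id : Fin m → Fin m) := by
    intro i
    refine Finset.card_image_le.trans ?_
    simpa [Finset.filter_eq'] using hk
  have hopt : ClOPT m k (clPrefix J m) ≤ 1 := by
    refine (ClOPT_le_makespan (fun j => hJ j.1) hid).trans ?_
    refine Real.sSup_le ?_ zero_le_one
    rintro _ ⟨i, rfl⟩
    simp [machineLoad, Finset.filter_eq', hlt i.1 i.2]
  -- After the fresh classes have arrived, all unit jobs must share a machine.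
  have hfeas : ClFeasible k (clPrefix J (m + (m * k - 1)))
      (R (m + (m * k - 1)) (clPrefix J (m + (m * k - 1)))) := by
    refine (hrob J hJ).1 _ ⟨fun j => ⟨(J j.1).2 / k, ?_⟩, clFeasible_of_div hk fun j => rfl⟩
    rw [Nat.div_lt_iff_lt_mul hk]
    have := j.2
    rcases lt_or_ge j.1 m with h | h
    · rw [hlt _ h]; exact hmk
    · rw [hge _ h]; dsimp only; omega
  have hcard : m * k ≤
      (Finset.univ.image fun j => (clPrefix J (m + (m * k - 1)) j).2).card := by
    refine (Finset.card_range (m * k)).ge.trans (Finset.card_le_card fun c hc => ?_)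
    rw [Finset.mem_range] at hc
    refine Finset.mem_image.2 ⟨⟨m + c - 1, by omega⟩, Finset.mem_univ _, ?_⟩
    change (J (m + c - 1)).2 = c
    rcases Nat.eq_zero_or_pos c with rfl | h
    · rw [hlt _ (by omega)]
    · rw [hge _ (by omega)]; dsimp only; omega
  have hsame : ∀ j : Fin m, R m (clPrefix J m) j = R m (clPrefix J m) ⟨0, by omega⟩ := by
    intro j
    have hzero : ∀ i, m ≤ i → (J i).1 = 0 := fun i hi => by rw [hge i hi]
    have hpos : ∀ i, i < m → 0 < (J i).1 := fun i hi => by rw [hlt i hi]; exact one_pos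
    rw [← hrob.eq_of_size_zero hJ hzero (m * k - 1) (show 0 < m by omega) (hpos 0 (by omega)),
      ← hrob.eq_of_size_zero hJ hzero (m * k - 1) j.2 (hpos j.1 j.2)]
    refine hfeas.eq_of_class_eq hcard ?_
    change (J j.1).2 = (J 0).2
    rw [hlt _ j.2, hlt 0 (by omega)]
  have hload : machineLoad (fun j : Fin m => (J j.1).1) (R m (clPrefix J m))
      (R m (clPrefix J m) ⟨0, by omega⟩) = m := by
    rw [machineLoad, Finset.filter_true_of_mem fun j _ => hsame j,
      Finset.sum_congr rfl fun (j : Fin m) _ => congrArg Prod.fst (hlt j.1 j.2)]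
    simp
  calc (m : ℝ) = _ := hload.symm
    _ ≤ _ := machineLoad_le_makespan _ _ _
    _ ≤ α * ClOPT m k (clPrefix J m) := hcomp J hJ m ⟨_, hid⟩
    _ ≤ α * 1 := mul_le_mul_of_nonneg_left hopt (zero_le_one.trans hα)
    _ = α := mul_one α
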